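/- arXiv:math/0508163 — 2 statements merged into one kernel-verified Lean document; each statement's English description precedes it below -/
import Mathlib

section
/- Let p be an odd prime and k a natural number with 2 ≤ k < p. Then (p + 1) / Nat.gcd (k - 1) (p + 1) > 2 if and only if p ≠ 2k - 3. -/
theorem technical_condition_iff (p k : ℕ) (hp : p.Prime) (hodd : Odd p)
    (hk2 : 2 ≤ k) (hkp : k < p) :
    (p + 1) / Nat.gcd (k - 1) (p + 1) > 2 ↔ p ≠ 2 * k - 3 := by
  constructor
  · rintro h rfl
    have hsucc : 2 * k - 3 + 1 = (k - 1) * 2 := by omega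
    rw [hsucc, Nat.gcd_mul_right_right, Nat.mul_div_cancel_left 2 (by omega)] at h
    omega
  · intro h
    have hpos : 0 < Nat.gcd (k - 1) (p + 1) := Nat.gcd_pos_of_pos_right _ p.succ_pos
    obtain ⟨m, hm⟩ := Nat.gcd_dvd_left (k - 1) (p + 1)
    obtain ⟨q, hq⟩ := Nat.gcd_dvd_right (k - 1) (p + 1)
    rw [Nat.div_eq_of_eq_mul_right hpos hq]
    generalize Nat.gcd (k - 1) (p + 1) = g at hm hq hpos
    by_contra! hq2
    have hmq : m < q := lt_of_mul_lt_mul_left (by omega : g * m < g * q) g.zero_le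
    have hm0 : m ≠ 0 := by
      rintro rfl
      omega
    obtain rfl : m = 1 := by omega
    obtain rfl : q = 2 := by omega
    omega
end

section
/- Let p be an odd prime and let g be a generator of the unit group of the field with p² elements, i.e. g ∈ (GaloisField p 2)ˣ with orderOf g = p² - 1. Let S be the subgroup of (GaloisField p 2)ˣ given by the range of Units.map (algebraMap (ZMod p) (GaloisField p 2)).toMonoidHom (the scalars coming from the prime field). Then the image of g ^ ((p + 1) / 2) in the quotient group (GaloisField p 2)ˣ ⧸ S has order exactly 2. -/
/-- A unit of a field of characteristic `p` comes from the prime field iff its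
`(p - 1)`-st power is trivial. -/
theorem Units.mem_range_map_algebraMap_zmod_iff (p : ℕ) [hp : Fact p.Prime] {K : Type*} [Field K]
    [Algebra (ZMod p) K] (u : Kˣ) :
    u ∈ (Units.map (algebraMap (ZMod p) K).toMonoidHom).range ↔ u ^ (p - 1) = 1 := by
  have : CharP K p := charP_of_injective_algebraMap (algebraMap (ZMod p) K).injective p
  constructor
  · rintro ⟨v, rfl⟩
    rw [← map_pow, ZMod.units_pow_card_sub_one_eq_one, map_one]
  · intro h
    have hu : (u : K) ^ p = u := by
      rw [← Nat.sub_add_cancel hp.out.one_le, pow_succ, ← Units.val_pow_eq_pow_val, h,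
        Units.val_one, one_mul]
    obtain ⟨n, hn⟩ := (mem_bot_iff_intCast p K).1
      ((Subfield.mem_bot_iff_pow_eq_self K p).2 hu)
    have hn' : algebraMap (ZMod p) K n = u := by rw [map_intCast, hn]
    have hn0 : (n : ZMod p) ≠ 0 := fun h0 ↦ u.ne_zero (by rw [← hn', h0, map_zero])
    exact ⟨Units.mk0 _ hn0, Units.ext hn'⟩

theorem orderOf_image_in_quotient_eq_two (p : ℕ) [Fact p.Prime] (hodd : Odd p)
    (g : (GaloisField p 2)ˣ) (hg : orderOf g = p ^ 2 - 1)
    (S : Subgroup (GaloisField p 2)ˣ)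
    (hS : S = (Units.map (algebraMap (ZMod p) (GaloisField p 2)).toMonoidHom).range) :
    orderOf ((QuotientGroup.mk (g ^ ((p + 1) / 2))) : (GaloisField p 2)ˣ ⧸ S) = 2 := by
  have hp : 2 ≤ p := (Fact.out : p.Prime).two_le
  have hmul : (p + 1) / 2 * 2 = p + 1 := Nat.div_mul_cancel hodd.add_one.two_dvd
  have hcard : p ^ 2 - 1 = (p + 1) * (p - 1) := by simpa using Nat.sq_sub_sq p 1
  refine orderOf_eq_prime ?_ ?_
  · rw [← QuotientGroup.mk_pow, QuotientGroup.eq_one_iff, hS,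
      Units.mem_range_map_algebraMap_zmod_iff, ← pow_mul, ← pow_mul, ← mul_assoc, hmul, ← hcard, ← hg,
      pow_orderOf_eq_one]
  · rw [Ne, QuotientGroup.eq_one_iff, hS, Units.mem_range_map_algebraMap_zmod_iff, ← pow_mul,
      ← orderOf_dvd_iff_pow_eq_one, hg, hcard]
    exact fun h ↦ absurd (Nat.le_of_dvd (by lia) (Nat.dvd_of_mul_dvd_mul_right (by lia) h)) (by lia)
end
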